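/- Assume T is dependent and G is abelian. Then there is a set P ⊆ S(A*) of complete 1-types over A* such that: (a) P(𝔠) := ⋃{p(𝔠) : p ∈ P} is a subgroup of G of bounded index, i.e. (G : P(𝔠)) < κ̄; (b) (G : P(𝔠)) ≤ 2^{|A*|+|T|+ℵ₀}; (c) P(𝔠) is minimal: if α < κ̄, ā ∈ ^α𝔠, ψ(x,ȳ) ∈ L_{∞,κ̄}(τ_T) and ψ(𝔠,ā) is a subgroup of G, then ψ(𝔠,ā) has bounded index in G if and only if ψ(𝔠,ā) ⊇ P(𝔠). -/

import Mathlib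

open FirstOrder Cardinal Set

universe u

namespace Paper886

section Basic

variable (L : FirstOrder.Language.{u, u}) (M : Type u) [L.Structure M]

/-- A first-order formula in `n` object variables together with a finite tuple of
parameters from `M`. -/
structure ParamFormula (n : ℕ) : Type u where
  m : ℕ
  toFormula : L.Formula (Fin n ⊕ Fin m)
  params : Fin m → M

variable {L M}

/-- Realization of a parametrized formula at a tuple. -/
def ParamFormula.Realize {n : ℕ} (f : ParamFormula L M n) (v : Fin n → M) : Prop :=
  f.toFormula.Realize (Sum.elim v f.params)

/-- The parameters of `f` all lie in `B`. -/
def ParamFormula.paramsIn {n : ℕ} (f : ParamFormula L M n) (B : Set M) : Prop :=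
  ∀ i, f.params i ∈ B

/-- The set of realizations of a partial 1-type. -/
def realizeSet (p : Set (ParamFormula L M 1)) : Set M :=
  {a | ∀ f ∈ p, f.Realize fun _ => a}

/-- The partial type `p` is over the parameter set `B`. -/
def IsTypeOver (p : Set (ParamFormula L M 1)) (B : Set M) : Prop :=
  ∀ f ∈ p, f.paramsIn B

variable (L) in
/-- Two tuples realize the same type over a set `A` of parameters. -/
def SameType {α : Type u} (A : Set M) (a b : α → M) : Prop :=
  ∀ (n mp : ℕ) (φ : L.Formula (Fin n ⊕ Fin mp)) (vs : Fin n → α) (ps : Fin mp → M),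
    (∀ i, ps i ∈ A) →
      (φ.Realize (Sum.elim (fun i => a (vs i)) ps) ↔ φ.Realize (Sum.elim (fun i => b (vs i)) ps))

variable (L M)

/-- `M` is `κ`-saturated: every finitely satisfiable 1-type over fewer than `κ`
parameters is realized in `M`. -/
def Saturated (κ : Cardinal.{u}) : Prop :=
  ∀ B : Set M, #B < κ → ∀ p : Set (ParamFormula L M 1), IsTypeOver p B →
    (∀ s : Set (ParamFormula L M 1), s ⊆ p → s.Finite → ∃ a : M, ∀ f ∈ s, f.Realize fun _ => a) →
    ∃ a : M, a ∈ realizeSet p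

/-- `Th(M)` is dependent (NIP): no formula has the independence property, where consistency
of a pattern is rendered as finite satisfiability in the (saturated) monster. -/
def IsDependent : Prop :=
  ∀ (nx np : ℕ) (φ : L.Formula (Fin nx ⊕ Fin np)) (a : ℕ → Fin np → M),
    ¬ ∀ (u : Set ℕ) (s : Finset ℕ), ∃ x : Fin nx → M,
        ∀ i ∈ s, (φ.Realize (Sum.elim x (a i)) ↔ i ∈ u)

variable {L M}

/-- The cardinality `|T|` of the (complete) theory of `M`. -/
noncomputable def theoryCard (L : FirstOrder.Language.{u, u}) : Cardinal.{u} :=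
  ℵ₀ ⊔ L.card

variable (L M)

/-- A type-definable group: a partial type `p*` over `A*` together with definitions
(over `A*`) of the group operations making `p*(𝔠)` a group. -/
structure DefGroup : Type u where
  AStar : Set M
  pStar : Set (ParamFormula L M 1)
  pStar_over : IsTypeOver pStar AStar
  mul : M → M → M
  inv : M → M
  one : M
  mul_definable : ∃ φ : ParamFormula L M 3, φ.paramsIn AStar ∧
    ∀ x y z : M, (φ.Realize ![x, y, z] ↔ mul x y = z)
  inv_definable : ∃ φ : ParamFormula L M 2, φ.paramsIn AStar ∧
    ∀ x y : M, (φ.Realize ![x, y] ↔ inv x = y)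
  one_definable : ∃ φ : ParamFormula L M 1, φ.paramsIn AStar ∧
    ∀ x : M, (φ.Realize ![x] ↔ x = one)
  one_mem' : one ∈ realizeSet pStar
  mul_mem' : ∀ x ∈ realizeSet pStar, ∀ y ∈ realizeSet pStar, mul x y ∈ realizeSet pStar
  inv_mem' : ∀ x ∈ realizeSet pStar, inv x ∈ realizeSet pStar
  mul_assoc' : ∀ x ∈ realizeSet pStar, ∀ y ∈ realizeSet pStar, ∀ z ∈ realizeSet pStar,
    mul (mul x y) z = mul x (mul y z)
  one_mul' : ∀ x ∈ realizeSet pStar, mul one x = x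
  mul_one' : ∀ x ∈ realizeSet pStar, mul x one = x
  inv_mul' : ∀ x ∈ realizeSet pStar, mul (inv x) x = one
  mul_inv' : ∀ x ∈ realizeSet pStar, mul x (inv x) = one

variable {L M}

namespace DefGroup

variable (D : DefGroup L M)

/-- The underlying set of the group `G = p*(𝔠)`. -/
def carrier : Set M := realizeSet D.pStar

/-- `G` is abelian. -/
def IsAbelian : Prop := ∀ x ∈ D.carrier, ∀ y ∈ D.carrier, D.mul x y = D.mul y x

/-- `H` is a subgroup of `G`. -/
def IsSubgroup (H : Set M) : Prop :=
  H ⊆ D.carrier ∧ D.one ∈ H ∧ (∀ x ∈ H, ∀ y ∈ H, D.mul x y ∈ H) ∧ ∀ x ∈ H, D.inv x ∈ H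

/-- `(G : H) ≤ c`: at most `c` left cosets of `H` cover `G`. -/
def indexLE (H : Set M) (c : Cardinal.{u}) : Prop :=
  ∃ S : Set M, S ⊆ D.carrier ∧ #S ≤ c ∧ ∀ g ∈ D.carrier, ∃ s ∈ S, D.mul (D.inv s) g ∈ H

/-- `(G : H) < c`: fewer than `c` left cosets of `H` cover `G`. -/
def indexLT (H : Set M) (c : Cardinal.{u}) : Prop :=
  ∃ S : Set M, S ⊆ D.carrier ∧ #S < c ∧ ∀ g ∈ D.carrier, ∃ s ∈ S, D.mul (D.inv s) g ∈ H

/-- The realization set of the partial type `q^n_Γ`. -/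
def qSet (Γ : Set (ParamFormula L M 1)) (n : ℕ) : Set M :=
  {c | ∃ d : Fin n → M × M,
    (∀ ℓ, (d ℓ).1 ∈ D.carrier ∧ (d ℓ).2 ∈ D.carrier) ∧
    (∀ ℓ, ∀ f ∈ Γ, (f.Realize fun _ => (d ℓ).1) ↔ (f.Realize fun _ => (d ℓ).2)) ∧
    c = (List.ofFn fun ℓ => D.mul (D.inv (d ℓ).1) (d ℓ).2).foldr D.mul D.one}

/-- The realization set of `q^n_{ā}`, i.e. `q^n_{Γ_ā}` where `Γ_ā` consists of all
formulas with parameters in the range of `ā`. -/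
def qTupleSet {α : Type u} (a : α → M) (n : ℕ) : Set M :=
  D.qSet {f : ParamFormula L M 1 | f.paramsIn (Set.range a)} n

end DefGroup

end Basic

variable {L : FirstOrder.Language.{u, u}} {M : Type u} [L.Structure M]

variable (L) in
/-- `X` is the union of fewer than `κ` realization sets of types over `B`. -/
def UnionTypeDefOver (X B : Set M) (κ : Cardinal.{u}) : Prop :=
  ∃ ι : Type u, #ι < κ ∧ ∃ P : ι → Set (ParamFormula L M 1),
    (∀ i, IsTypeOver (P i) B) ∧ X = ⋃ i, realizeSet (P i)

variable (L) in
/-- `X` is union-type-definable (with fewer than `κ` parameters altogether). -/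
def UnionTypeDefinable (X : Set M) (κ : Cardinal.{u}) : Prop :=
  ∃ B : Set M, #B < κ ∧ UnionTypeDefOver L X B κ

/-- `G_q = (p* ∪ q)(𝔠)`. -/
def Gq (D : DefGroup L M) (q : Set (ParamFormula L M 1)) : Set M :=
  realizeSet (D.pStar ∪ q)

/-- `R_B`: the family of 1-types `q` over `B` such that `G_q` is a subgroup of `G`
of index `< κ`. -/
def RB (D : DefGroup L M) (κ : Cardinal.{u}) (B : Set M) : Set (Set (ParamFormula L M 1)) :=
  {q | IsTypeOver q B ∧ D.IsSubgroup (Gq D q) ∧ D.indexLT (Gq D q) κ}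

/-- `q_B`, the union of all members of `R_B`. -/
def qB (D : DefGroup L M) (κ : Cardinal.{u}) (B : Set M) : Set (ParamFormula L M 1) :=
  ⋃₀ RB D κ B

/-- `G_B = q_B(𝔠) ∩ G`. -/
def GB (D : DefGroup L M) (κ : Cardinal.{u}) (B : Set M) : Set M :=
  realizeSet (qB D κ B) ∩ D.carrier

/-- The complete type of `a` over `A` (as the set of all param-formulas over `A`
satisfied by `a`). -/
def typeOf (A : Set M) (a : M) : Set (ParamFormula L M 1) :=
  {f | f.paramsIn A ∧ f.Realize fun _ => a}

/-- `φ(x̄, ȳ₀, …, ȳ_{k-1})` is `k`-independent: for every index set of size `< κ` there is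
an array of parameter tuples such that every pattern on `^k ι` is (finitely) satisfiable. -/
def FormulaKIndep (M : Type u) [L.Structure M] (κ : Cardinal.{u}) (k nx : ℕ) (ny : Fin k → ℕ)
    (φ : L.Formula (Fin nx ⊕ ((ℓ : Fin k) × Fin (ny ℓ)))) : Prop :=
  ∀ ι : Type u, #ι < κ →
    ∃ a : (ℓ : Fin k) → ι → Fin (ny ℓ) → M,
      ∀ (u : Set (Fin k → ι)) (s : Finset (Fin k → ι)),
        ∃ x : Fin nx → M,
          ∀ η ∈ s, ((φ.Realize (Sum.elim x fun p => a p.1 (η p.1) p.2)) ↔ η ∈ u)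

/-- `Th(M)` is `k`-independent. -/
def KIndependent (L : FirstOrder.Language.{u, u}) (M : Type u) [L.Structure M] (κ : Cardinal.{u})
    (k : ℕ) : Prop :=
  ∃ (nx : ℕ) (ny : Fin k → ℕ) (φ : L.Formula (Fin nx ⊕ ((ℓ : Fin k) × Fin (ny ℓ)))),
    FormulaKIndep M κ k nx ny φ

/-- `Th(M)` is `k`-dependent. -/
def KDependent (L : FirstOrder.Language.{u, u}) (M : Type u) [L.Structure M] (κ : Cardinal.{u})
    (k : ℕ) : Prop :=
  ¬ KIndependent L M κ k

/-! ### Relations definable over a parameter set -/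

/-- The relation `R` on `δ`-tuples is definable with parameters from `A`. -/
def RelDefinable (L : FirstOrder.Language.{u, u}) {M : Type u} [L.Structure M] {δ : Type*}
    (A : Set M) (R : (δ → M) → Prop) : Prop :=
  ∃ φ : L.Formula (A ⊕ δ), ∀ v, φ.Realize (Sum.elim Subtype.val v) ↔ R v

/-- The unary predicate `R` is definable with parameters from `A`. -/
def PredDefinable (L : FirstOrder.Language.{u, u}) {M : Type u} [L.Structure M]
    (A : Set M) (R : M → Prop) : Prop :=
  RelDefinable L A fun v : Fin 1 → M => R (v 0)

theorem exists_finset_restrict {α : Type*} (φ : L.Formula α) :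
    ∃ s : Finset α, ∃ ψ : L.Formula s, ∀ v : α → M,
      ψ.Realize (fun i => v i) ↔ φ.Realize v := by
  classical
  exact ⟨φ.freeVarFinset, φ.restrictFreeVar id, fun v =>
    FirstOrder.Language.BoundedFormula.realize_restrictFreeVar v fun a => rfl⟩

namespace RelDefinable

variable {A B : Set M} {δ ε : Type*}

theorem congr {R S : (δ → M) → Prop} (h : RelDefinable L A R) (e : ∀ v, R v ↔ S v) :
    RelDefinable L A S := by
  obtain ⟨φ, hφ⟩ := h
  exact ⟨φ, fun v => (hφ v).trans (e v)⟩

/-- Substituting variables and parameters in a definable relation. -/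
theorem subst {R : (δ → M) → Prop} (h : RelDefinable L A R) (g : δ → A ⊕ ε) :
    RelDefinable L A fun v : ε → M => R fun i => Sum.elim Subtype.val v (g i) := by
  obtain ⟨φ, hφ⟩ := h
  refine ⟨φ.relabel (Sum.elim Sum.inl g), fun v => ?_⟩
  rw [FirstOrder.Language.Formula.realize_relabel]
  refine Iff.trans (iff_of_eq ?_) (hφ _)
  congr 1
  ext x
  rcases x with x | x <;> rfl

theorem comp {R : (δ → M) → Prop} (h : RelDefinable L A R) (g : δ → ε) :
    RelDefinable L A fun v : ε → M => R fun i => v (g i) :=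
  h.subst fun i => Sum.inr (g i)

theorem mono {R : (δ → M) → Prop} (h : RelDefinable L A R) (hAB : A ⊆ B) :
    RelDefinable L B R := by
  obtain ⟨φ, hφ⟩ := h
  refine ⟨φ.relabel (Sum.map (Set.inclusion hAB) id), fun v => ?_⟩
  rw [FirstOrder.Language.Formula.realize_relabel, ← hφ]
  apply iff_of_eq
  congr 1
  ext x
  rcases x with x | x <;> rfl

theorem not {R : (δ → M) → Prop} (h : RelDefinable L A R) :
    RelDefinable L A fun v => ¬ R v := by
  obtain ⟨φ, hφ⟩ := h
  exact ⟨φ.not, fun v => by rw [FirstOrder.Language.Formula.realize_not, hφ]⟩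

theorem and {R S : (δ → M) → Prop} (h : RelDefinable L A R) (h' : RelDefinable L A S) :
    RelDefinable L A fun v => R v ∧ S v := by
  obtain ⟨φ, hφ⟩ := h
  obtain ⟨ψ, hψ⟩ := h'
  exact ⟨φ ⊓ ψ, fun v => by rw [FirstOrder.Language.Formula.realize_inf, hφ, hψ]⟩

theorem iff {R S : (δ → M) → Prop} (h : RelDefinable L A R) (h' : RelDefinable L A S) :
    RelDefinable L A fun v => (R v ↔ S v) := by
  obtain ⟨φ, hφ⟩ := h
  obtain ⟨ψ, hψ⟩ := h'
  exact ⟨φ.iff ψ, fun v => by rw [FirstOrder.Language.Formula.realize_iff, hφ, hψ]⟩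

theorem forall_finite {ι : Type*} [Finite ι] {R : ι → (δ → M) → Prop}
    (h : ∀ i, RelDefinable L A (R i)) : RelDefinable L A fun v => ∀ i, R i v := by
  choose φ hφ using h
  exact ⟨FirstOrder.Language.Formula.iInf φ, fun v => by
    simp [FirstOrder.Language.Formula.realize_iInf, hφ]⟩

theorem const (p : Prop) : RelDefinable L A fun _ : δ → M => p := by
  by_cases hp : p
  · exact ⟨⊤, fun _ => by simp [hp, FirstOrder.Language.Formula.Realize]⟩
  · exact ⟨⊥, fun _ => by simp [hp, FirstOrder.Language.Formula.Realize]⟩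

theorem exists_tuple [Finite ε] {R : (δ → M) → (ε → M) → Prop}
    (h : RelDefinable L A fun w : δ ⊕ ε → M => R (fun i => w (Sum.inl i)) fun i => w (Sum.inr i)) :
    RelDefinable L A fun v => ∃ u, R v u := by
  obtain ⟨φ, hφ⟩ := h
  refine ⟨(φ.relabel (Equiv.sumAssoc A δ ε).symm).iExs ε, fun v => ?_⟩
  rw [FirstOrder.Language.Formula.realize_iExs]
  refine exists_congr fun u => ?_
  rw [FirstOrder.Language.Formula.realize_relabel]
  refine Iff.trans (iff_of_eq ?_) (hφ (Sum.elim v u))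
  congr 1
  ext x
  rcases x with x | x | x <;> rfl

theorem exists_elem {R : (δ → M) → M → Prop}
    (h : RelDefinable L A fun w : δ ⊕ Fin 1 → M => R (fun i => w (Sum.inl i)) (w (Sum.inr 0))) :
    RelDefinable L A fun v => ∃ u, R v u :=
  (exists_tuple (R := fun v (u : Fin 1 → M) => R v (u 0)) h).congr fun _ =>
    ⟨fun ⟨u, hu⟩ => ⟨u 0, hu⟩, fun ⟨u, hu⟩ => ⟨fun _ => u, hu⟩⟩

theorem pred {R : M → Prop} (h : PredDefinable L A R) (i : δ) :
    RelDefinable L A fun v : δ → M => R (v i) :=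
  RelDefinable.comp (R := fun v : Fin 1 → M => R (v 0)) h fun _ => i

theorem eq (i j : δ) : RelDefinable L A fun v : δ → M => v i = v j :=
  ⟨FirstOrder.Language.Term.equal (.var (Sum.inr i)) (.var (Sum.inr j)), fun v => by
    simp [FirstOrder.Language.Formula.realize_equal]⟩

/-- A definable relation depends on finitely many variables. -/
theorem exists_finset {R : (δ → M) → Prop} (h : RelDefinable L A R) :
    ∃ s : Finset δ, ∃ S : (s → M) → Prop, RelDefinable L A S ∧ ∀ v, S (fun i => v i) ↔ R v := by
  classical
  obtain ⟨φ, hφ⟩ := h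
  obtain ⟨s, ψ, hψ⟩ := exists_finset_restrict (M := M) φ
  refine ⟨s.toRight, fun w => ψ.Realize fun i =>
    Sum.casesOn (motive := fun z => z ∈ s → M) i.1 (fun a _ => a.1)
      (fun d hd => w ⟨d, by simpa using hd⟩) i.2, ?_, ?_⟩
  · refine ⟨ψ.relabel fun i => Sum.casesOn (motive := fun z => z ∈ s → A ⊕ s.toRight) i.1
      (fun a _ => Sum.inl a) (fun d hd => Sum.inr ⟨d, by simpa using hd⟩) i.2, fun v => ?_⟩
    rw [FirstOrder.Language.Formula.realize_relabel]
    apply iff_of_eq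
    congr 1
    ext ⟨x, hx⟩
    rcases x with x | x <;> rfl
  · intro v
    rw [← hφ, ← hψ]
    apply iff_of_eq
    refine congrArg ψ.Realize (funext fun ⟨x, hx⟩ => ?_)
    rcases x with x | x <;> rfl

/-- A definable relation uses finitely many parameters. -/
theorem exists_finite_params {R : (δ → M) → Prop} (h : RelDefinable L A R) :
    ∃ B : Set M, B.Finite ∧ B ⊆ A ∧ RelDefinable L B R := by
  classical
  obtain ⟨φ, hφ⟩ := h
  obtain ⟨s, ψ, hψ⟩ := exists_finset_restrict (M := M) φ
  refine ⟨Subtype.val '' (s.toLeft : Set A), (s.toLeft.finite_toSet).image _, by simp, ?_⟩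
  refine ⟨ψ.relabel fun i => Sum.casesOn (motive := fun z => z ∈ s →
    (Subtype.val '' (s.toLeft : Set A) : Set M) ⊕ δ) i.1
      (fun a ha => Sum.inl ⟨a.1, a, by simpa using ha, rfl⟩) (fun d _ => Sum.inr d) i.2,
      fun v => ?_⟩
  rw [FirstOrder.Language.Formula.realize_relabel, ← hφ, ← hψ]
  apply iff_of_eq
  congr 1
  ext ⟨x, hx⟩
  rcases x with x | x <;> rfl

/-- Parameters enumerated by a tuple can be turned into variables. -/
theorem exists_formula_of_range {γ : Type*} {a : γ → M} {R : (δ → M) → Prop}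
    (h : RelDefinable L (Set.range a) R) :
    ∃ φ : L.Formula (δ ⊕ γ), ∀ v, φ.Realize (Sum.elim v a) ↔ R v := by
  obtain ⟨φ, hφ⟩ := h
  choose f hf using fun x : Set.range a => x.2
  refine ⟨φ.relabel (Sum.elim (fun x => Sum.inr (f x)) Sum.inl), fun v => ?_⟩
  rw [FirstOrder.Language.Formula.realize_relabel, ← hφ]
  apply iff_of_eq
  congr 1
  ext x
  rcases x with x | x
  · exact hf x
  · rfl

theorem of_formula {γ : Type*} (φ : L.Formula (δ ⊕ γ)) (a : γ → M) (ha : ∀ i, a i ∈ A) :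
    RelDefinable L A fun v : δ → M => φ.Realize (Sum.elim v a) := by
  refine ⟨φ.relabel (Sum.elim Sum.inr fun i => Sum.inl ⟨a i, ha i⟩), fun v => ?_⟩
  rw [FirstOrder.Language.Formula.realize_relabel]
  apply iff_of_eq
  congr 1
  ext x
  rcases x with x | x <;> rfl

theorem of_paramFormula {n : ℕ} (f : ParamFormula L M n) (hf : f.paramsIn A) :
    RelDefinable L A fun v : Fin n → M => f.Realize v :=
  of_formula f.toFormula f.params hf

theorem of_fixed {R : (δ ⊕ ε → M) → Prop} (h : RelDefinable L A R) (c : δ → M) :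
    RelDefinable L (A ∪ Set.range c) fun v : ε → M => R (Sum.elim c v) := by
  refine ((h.mono (B := A ∪ Set.range c) subset_union_left).subst (ε := ε)
    (Sum.elim (fun i => Sum.inl ⟨c i, Or.inr ⟨i, rfl⟩⟩) Sum.inr)).congr fun v => iff_of_eq ?_
  congr 1
  ext x
  rcases x with x | x <;> rfl

/-- Finite-tuple form: a relation definable over `A` is given by a parametrized formula. -/
theorem exists_fin_params {n : ℕ} {R : (Fin n → M) → Prop} (h : RelDefinable L A R) :
    ∃ f : ParamFormula L M n, f.paramsIn A ∧ ∀ v, f.Realize v ↔ R v := by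
  obtain ⟨B, hB, hBA, h⟩ := h.exists_finite_params
  obtain ⟨m, a, -, rfl⟩ := hB.fin_param
  obtain ⟨φ, hφ⟩ := h.exists_formula_of_range
  exact ⟨⟨m, φ, a⟩, fun i => hBA ⟨i, rfl⟩, hφ⟩

end RelDefinable

theorem PredDefinable.mono {A B : Set M} {R : M → Prop} (h : PredDefinable L A R) (hAB : A ⊆ B) :
    PredDefinable L B R :=
  RelDefinable.mono h hAB

theorem PredDefinable.of_paramFormula {A : Set M} {f : ParamFormula L M 1} (hf : f.paramsIn A) :
    PredDefinable L A fun a => f.Realize fun _ => a :=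
  (RelDefinable.of_paramFormula f hf).congr fun v => iff_of_eq (by
    congr 1
    ext i
    rw [Subsingleton.elim i 0])

/-! ### Saturation and ultralimits of tuples -/

theorem Saturated.exists_forall_mem {κ : Cardinal.{u}} (hsat : Saturated L M κ) {A : Set M}
    (hA : #A < κ) (p : Set (M → Prop)) (hp : ∀ R ∈ p, PredDefinable L A R)
    (hfin : ∀ s ⊆ p, s.Finite → ∃ a, ∀ R ∈ s, R a) : ∃ a, ∀ R ∈ p, R a := by
  obtain ⟨a, ha⟩ := hsat A hA
    {f | f.paramsIn A ∧ (fun a => f.Realize fun _ => a) ∈ p} (fun f hf => hf.1) fun s hs hsf => by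
      obtain ⟨a, ha⟩ := hfin ((fun f a => f.Realize fun _ => a) '' s)
        (by rintro _ ⟨f, hf, rfl⟩; exact (hs hf).2) (hsf.image _)
      exact ⟨a, fun f hf => ha _ ⟨f, hf, rfl⟩⟩
  refine ⟨a, fun R hR => ?_⟩
  obtain ⟨f, hf, hfR⟩ := (hp R hR).exists_fin_params
  have e : (fun a => f.Realize fun _ => a) = R := funext fun a => propext (hfR _)
  rw [← e]
  exact ha f ⟨hf, e ▸ hR⟩

/-- The tuple `c` satisfies over `A` exactly the definable relations satisfied by
`U`-almost all of the tuples `v t`. -/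
def IsUltralimit (L : FirstOrder.Language.{u, u}) {M : Type u} [L.Structure M] (A : Set M)
    {ι γ : Type*} (U : Ultrafilter ι) (c : γ → M) (v : ι → γ → M) : Prop :=
  ∀ R : (γ → M) → Prop, RelDefinable L A R → (R c ↔ ∀ᶠ t in (U : Filter ι), R (v t))

namespace IsUltralimit

variable {κ : Cardinal.{u}} {A : Set M} {ι γ δ : Type*} {U : Ultrafilter ι} {c : γ → M}
  {v : ι → γ → M}

theorem comp (h : IsUltralimit L A U c v) (g : δ → γ) :
    IsUltralimit L A U (fun i => c (g i)) fun t i => v t (g i) :=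
  fun _ hR => h _ (hR.comp g)

theorem congr {c' : γ → M} {v' : ι → γ → M} (h : IsUltralimit L A U c v)
    (hc : ∀ i, c i = c' i) (hv : ∀ t i, v t i = v' t i) : IsUltralimit L A U c' v' := by
  obtain rfl : c = c' := funext hc
  obtain rfl : v = v' := funext fun t => funext (hv t)
  exact h

theorem of_finset (h : ∀ s : Finset γ, IsUltralimit L A U (fun i : s => c i) fun t i => v t i) :
    IsUltralimit L A U c v := by
  intro R hR
  obtain ⟨s, S, hS, e⟩ := hR.exists_finset
  simpa only [e] using h s S hS

theorem exists_elem (h : IsUltralimit L A U c v) (hsat : Saturated L M κ) (hκ : ℵ₀ ≤ κ)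
    (hA : #A < κ) (hc : #(Set.range c) < κ) (w : ι → M) :
    ∃ x, IsUltralimit L A U (Sum.elim c fun _ : Fin 1 => x)
      fun t => Sum.elim (v t) fun _ => w t := by
  let p : Set (M → Prop) := {R | ∃ S : (γ ⊕ Fin 1 → M) → Prop, RelDefinable L A S ∧
    (∀ᶠ t in (U : Filter ι), S (Sum.elim (v t) fun _ => w t)) ∧
      R = fun x => S (Sum.elim c fun _ => x)}
  have key : ∀ s : Set (M → Prop), s.Finite → s ⊆ p →
      ∃ S : (γ ⊕ Fin 1 → M) → Prop, RelDefinable L A S ∧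
        (∀ᶠ t in (U : Filter ι), S (Sum.elim (v t) fun _ => w t)) ∧
          ∀ x, S (Sum.elim c fun _ => x) → ∀ R ∈ s, R x := by
    intro s hs
    induction s, hs using Set.Finite.induction_on with
    | empty => exact fun _ => ⟨fun _ => True, .const _, by simp, by simp⟩
    | @insert R s _ _ ih =>
      intro hsub
      obtain ⟨S, hS, hSU, hSs⟩ := ih fun R hR => hsub (Or.inr hR)
      obtain ⟨S', hS', hSU', rfl⟩ := hsub (Or.inl rfl)
      refine ⟨_, hS.and hS', hSU.and hSU', fun x hx R hR => ?_⟩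
      rcases hR with rfl | hR
      · exact hx.2
      · exact hSs x hx.1 R hR
  obtain ⟨x, hx⟩ := hsat.exists_forall_mem (A := A ∪ Set.range c)
    ((mk_union_le _ _).trans_lt (add_lt_of_lt hκ hA hc)) p (by
      rintro _ ⟨S, hS, -, rfl⟩
      refine (hS.of_fixed c).congr fun v => iff_of_eq (congrArg (fun z => S (Sum.elim c z)) ?_)
      ext i
      rw [Subsingleton.elim i 0]) fun s hs hsf => by
      obtain ⟨S, hS, hSU, hSs⟩ := key s hsf hs
      have hex := (h _ (RelDefinable.exists_elem
        (R := fun c x => S (Sum.elim c fun _ => x)) (hS.congr fun w => iff_of_eq (congrArg S (by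
          ext i
          rcases i with i | i
          · rfl
          · exact congrArg w (congrArg Sum.inr (Subsingleton.elim _ _))))))).2
            (hSU.mono fun t ht => ⟨w t, ht⟩)
      obtain ⟨x, hx⟩ := hex
      exact ⟨x, hSs x hx⟩
  refine ⟨x, fun R hR => ⟨fun hRx => ?_, fun hRU => hx _ ⟨R, hR, hRU, rfl⟩⟩⟩
  by_contra hcon
  exact hx _ ⟨_, hR.not, Ultrafilter.eventually_not.2 hcon, rfl⟩ hRx

theorem exists_seq (h : IsUltralimit L A U c v) (hsat : Saturated L M κ) (hκ : ℵ₀ ≤ κ)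
    (hA : #A < κ) (hc : #(Set.range c) < κ) (w : ι → ℕ → M) :
    ∃ b : ℕ → M, IsUltralimit L A U (Sum.elim c b) fun t => Sum.elim (v t) (w t) := by
  classical
  let Good : ℕ → (ℕ → M) → Prop := fun n b => IsUltralimit L A U
    (Sum.elim c fun i : Fin n => b i) fun t => Sum.elim (v t) fun i : Fin n => w t i
  have good_congr : ∀ n b b', (∀ i < n, b i = b' i) → Good n b → Good n b' := by
    intro n b b' hbb hb
    have e : (fun i : Fin n => b i) = fun i : Fin n => b' i := funext fun i => hbb i i.2
    simpa only [Good, e] using hb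
  obtain ⟨t₀⟩ : Nonempty ι := Filter.nonempty_of_neBot (U : Filter ι)
  have good_zero : Good 0 (w t₀) := by
    refine (h.comp fun i : γ ⊕ Fin 0 => i.elim id Fin.elim0).congr ?_ fun t => ?_
    all_goals
      rintro (i | i)
      · rfl
      · exact i.elim0
  have good_succ : ∀ n b, Good n b → ∃ x, Good (n + 1) (Function.update b n x) := by
    intro n b hb
    obtain ⟨x, hx⟩ := hb.exists_elem hsat hκ hA (by
      rw [Set.Sum.elim_range]
      exact (mk_union_le _ _).trans_lt (add_lt_of_lt hκ hc
        (((Set.finite_range _).lt_aleph0).trans_le hκ))) fun t => w t n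
    refine ⟨x, ?_⟩
    refine (hx.comp fun i : γ ⊕ Fin (n + 1) =>
      i.elim (fun j => Sum.inl (Sum.inl j))
        (Fin.lastCases (Sum.inr 0) fun j => Sum.inl (Sum.inr j))).congr ?_ fun t => ?_
    · rintro (i | i)
      · rfl
      · induction i using Fin.lastCases with
        | last => simp
        | cast j => simp [j.2.ne]
    · rintro (i | i)
      · rfl
      · induction i using Fin.lastCases with
        | last => simp
        | cast j => simp
  have : Nonempty M := ⟨w t₀ 0⟩
  choose! next hnext using good_succ
  let f : ∀ n, {b // Good n b} := fun n => Nat.rec ⟨w t₀, good_zero⟩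
    (fun n b => ⟨Function.update b.1 n (next n b.1), hnext n b.1 b.2⟩) n
  let b : ℕ → M := fun j => (f (j + 1)).1 j
  have hfb : ∀ n, ∀ i < n, (f n).1 i = b i := by
    intro n
    induction n with
    | zero => simp
    | succ n ih =>
      intro i hi
      rcases Nat.lt_succ_iff_lt_or_eq.1 hi with hi | rfl
      · rw [← ih i hi]
        exact Function.update_of_ne hi.ne _ _
      · rfl
  have hb : ∀ n, Good n b := fun n => good_congr n _ _ (hfb n) (f n).2
  refine ⟨b, of_finset fun s => ?_⟩
  obtain ⟨n, hn⟩ : ∃ n, ∀ j, (Sum.inr j : γ ⊕ ℕ) ∈ s → j < n := by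
    obtain ⟨n, hn⟩ := s.toRight.bddAbove
    exact ⟨n + 1, fun j hj => Nat.lt_succ_of_le (hn (by simpa using hj))⟩
  refine ((hb n).comp fun i : s => Sum.casesOn (motive := fun z => z ∈ s → γ ⊕ Fin n) i.1
    (fun j _ => Sum.inl j) (fun j hj => Sum.inr ⟨j, hn j hj⟩) i.2).congr ?_ fun t => ?_
  all_goals
    rintro ⟨i | i, hi⟩ <;> rfl

theorem exists_countable [Nonempty M] [Countable δ] (h : IsUltralimit L A U c v)
    (hsat : Saturated L M κ) (hκ : ℵ₀ ≤ κ) (hA : #A < κ) (hc : #(Set.range c) < κ) (w : ι → δ → M) :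
    ∃ b : δ → M, IsUltralimit L A U (Sum.elim c b) fun t => Sum.elim (v t) (w t) := by
  obtain ⟨g, hg⟩ := exists_injective_nat δ
  obtain ⟨x₀⟩ := ‹Nonempty M›
  obtain ⟨b, hb⟩ := h.exists_seq hsat hκ hA hc fun t => Function.extend g (w t) fun _ => x₀
  refine ⟨fun i => b (g i), (hb.comp (Sum.map id g)).congr ?_ fun t => ?_⟩
  · rintro (i | i) <;> rfl
  · rintro (i | i)
    · rfl
    · exact hg.extend_apply (w t) (fun _ => x₀) i

end IsUltralimit

theorem Saturated.exists_isUltralimit {κ : Cardinal.{u}} (hsat : Saturated L M κ) (hκ : ℵ₀ ≤ κ)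
    {A : Set M} (hA : #A < κ) {ι δ : Type*} [Nonempty M] [Countable δ] (U : Ultrafilter ι)
    (w : ι → δ → M) : ∃ b : δ → M, IsUltralimit L A U b w := by
  have h : IsUltralimit L A U (Empty.elim : Empty → M) fun _ => Empty.elim := fun R _ => by simp
  obtain ⟨b, hb⟩ := h.exists_countable hsat hκ hA
    (((Set.finite_range _).lt_aleph0).trans_le hκ) w
  exact ⟨b, hb.comp Sum.inr⟩

/-! ### Combinatorics: Ramsey's theorem and dependence -/

/-- Ramsey's theorem: a colouring of increasing tuples with finitely many colours has an
infinite homogeneous set. -/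
theorem exists_strictMono_homogeneous {α : Type*} [Finite α] (r : ℕ) (c : (Fin r → ℕ) → α) :
    ∃ s : ℕ → ℕ, StrictMono s ∧ ∃ a, ∀ t : Fin r → ℕ, StrictMono t → c (fun i => s (t i)) = a := by
  induction r with
  | zero => exact ⟨id, strictMono_id, c Fin.elim0, fun t _ => congrArg c (Subsingleton.elim _ _)⟩
  | succ r ih =>
    have hlim : ∀ t : Fin r → ℕ, ∃ a, ∀ᶠ n in (Filter.hyperfilter ℕ : Filter ℕ),
        c (Fin.snoc (α := fun _ => ℕ) t n) = a := fun t =>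
      Ultrafilter.eventually_exists_iff.1 (.of_forall fun n => ⟨_, rfl⟩)
    choose c' hc' using hlim
    obtain ⟨s, -, hs⟩ := exists_seq_of_forall_finset_exists (fun _ : ℕ => True)
      (fun x y => x < y ∧ ∀ t : Fin r → ℕ, (∀ i, t i ≤ x) →
        c (Fin.snoc (α := fun _ => ℕ) t y) = c' t) fun s _ => by
        have h : ∀ᶠ y in (Filter.hyperfilter ℕ : Filter ℕ), ∀ x ∈ s, x < y ∧
            ∀ t : Fin r → ℕ, (∀ i, t i ≤ x) → c (Fin.snoc (α := fun _ => ℕ) t y) = c' t := by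
          refine (Filter.eventually_all_finset s).2 fun x _ => .and ?_ ?_
          · exact Filter.Tendsto.eventually_gt_atTop
              (Filter.tendsto_id.mono_left (Nat.hyperfilter_le_atTop)) x
          · have hfin : {t : Fin r → ℕ | ∀ i, t i ≤ x}.Finite := by
              simpa [Set.pi] using Set.Finite.pi' fun _ : Fin r => Set.finite_Iic x
            exact (Filter.eventually_all_finite hfin).2 fun t _ => hc' t
        obtain ⟨y, hy⟩ := h.exists
        exact ⟨y, trivial, hy⟩
    have hmono : StrictMono s := fun m n h => (hs m n h).1
    obtain ⟨s', hs', a, ha⟩ := ih fun t => c' fun i => s (t i + 1)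
    refine ⟨fun n => s (s' n + 1), fun m n h => hmono (Nat.succ_lt_succ (hs' h)), a,
      fun t ht => ?_⟩
    rw [← ha (fun i => t i.castSucc) fun i j h => ht (Fin.castSucc_lt_castSucc_iff.2 h),
      ← (hs (s' (t (Fin.last r))) (s' (t (Fin.last r)) + 1) (Nat.lt_succ_self _)).2
        (fun i => s (s' (t i.castSucc) + 1))
        fun i => hmono.monotone (hs' (ht (Fin.castSucc_lt_last i)))]
    congr 1
    ext i
    induction i using Fin.lastCases <;> simp

theorem IsDependent.not_forall_pattern (hdep : IsDependent L M) {A : Set M}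
    {R : (Fin 1 ⊕ ℕ → M) → Prop} (hR : RelDefinable L A R) (a : ℕ → ℕ → M) :
    ¬ ∀ (u : Set ℕ) (s : Finset ℕ), ∃ x : M,
      ∀ i ∈ s, (R (Sum.elim (fun _ => x) (a i)) ↔ i ∈ u) := by
  intro h
  obtain ⟨B, hB, -, hRB⟩ := hR.exists_finite_params
  obtain ⟨m, b, -, rfl⟩ := hB.fin_param
  obtain ⟨φ, hφ⟩ := hRB.exists_formula_of_range
  obtain ⟨s, ψ, hψ⟩ := exists_finset_restrict (M := M) φ
  obtain ⟨n, hn⟩ : ∃ n, ∀ j, (Sum.inl (Sum.inr j) : (Fin 1 ⊕ ℕ) ⊕ Fin m) ∈ s → j < n := by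
    obtain ⟨n, hn⟩ := s.toLeft.toRight.bddAbove
    exact ⟨n + 1, fun j hj => Nat.lt_succ_of_le (hn (by simpa using hj))⟩
  let g : s → Fin 1 ⊕ Fin (n + m) := fun z => Subtype.casesOn z fun z hz => by
    rcases z with (i | j) | k
    · exact Sum.inl i
    · exact Sum.inr (Fin.castAdd m ⟨j, hn j hz⟩)
    · exact Sum.inr (Fin.natAdd n k)
  refine hdep 1 (n + m) (ψ.relabel g)
    (fun i => Fin.append (fun j : Fin n => a i j) b) fun u t => ?_
  obtain ⟨x, hx⟩ := h u t
  refine ⟨fun _ => x, fun i hi => ?_⟩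
  rw [← hx i hi, ← hφ, ← hψ, FirstOrder.Language.Formula.realize_relabel]
  apply iff_of_eq
  refine congrArg ψ.Realize (funext fun ⟨z, hz⟩ => ?_)
  rcases z with (z | z) | z
  · rfl
  · exact Fin.append_left (fun j : Fin n => a i j) b ⟨z, hn z hz⟩
  · simp [g]

/-- In a dependent theory the length of independent sequences for a definable relation
is bounded. -/
theorem IsDependent.exists_bound (hdep : IsDependent L M) {κ : Cardinal.{u}}
    (hsat : Saturated L M κ) (hκ : ℵ₀ ≤ κ) {A : Set M} (hA : #A < κ)
    {R : (Fin 1 ⊕ ℕ → M) → Prop} (hR : RelDefinable L A R) :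
    ∃ k : ℕ, ∀ a : ℕ → ℕ → M, ¬ ∀ u : Set ℕ, ∃ x : M,
      ∀ i < k, (R (Sum.elim (fun _ => x) (a i)) ↔ i ∈ u) := by
  by_contra! h
  choose a ha using h
  have : Nonempty M := ⟨a 0 0 0⟩
  obtain ⟨b, hb⟩ := hsat.exists_isUltralimit hκ hA (Filter.hyperfilter ℕ)
    fun k (p : ℕ × ℕ) => a k p.1 p.2
  refine hdep.not_forall_pattern hR (fun i j => b (i, j)) fun u s => ?_
  refine (hb (fun w => ∃ x : M, ∀ i : s,
    (R (Sum.elim (fun _ => x) fun j => w (i.1, j)) ↔ i.1 ∈ u)) ?_).2 ?_ |>.imp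
      fun x hx i hi => hx ⟨i, hi⟩
  · refine RelDefinable.exists_elem (R := fun w x => ∀ i : s,
      (R (Sum.elim (fun _ => x) fun j => w (i.1, j)) ↔ i.1 ∈ u))
        (RelDefinable.forall_finite fun i => RelDefinable.iff ?_ (.const _))
    refine (hR.comp (Sum.elim (fun _ => Sum.inr (0 : Fin 1))
      fun j => Sum.inl (i.1, j))).congr fun v => iff_of_eq (congrArg R ?_)
    ext z
    rcases z with z | z <;> rfl
  · obtain ⟨n, hn⟩ := s.bddAbove
    refine (Filter.Tendsto.eventually_gt_atTop
      (Filter.tendsto_id.mono_left (Nat.hyperfilter_le_atTop)) n).mono fun k hk => ?_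
    obtain ⟨x, hx⟩ := ha k u
    exact ⟨x, fun i => hx i ((hn i.2).trans_lt hk)⟩

/-! ### Definable functions -/

/-- The function `f` on `δ`-tuples is definable with parameters from `A`. -/
def FunDefinable (L : FirstOrder.Language.{u, u}) {M : Type u} [L.Structure M] {δ : Type*}
    (A : Set M) (f : (δ → M) → M) : Prop :=
  RelDefinable L A fun w : δ ⊕ Fin 1 → M => f (fun i => w (Sum.inl i)) = w (Sum.inr 0)

namespace FunDefinable

variable {A : Set M} {δ : Type*} {f : (δ → M) → M}

theorem var (i : δ) : FunDefinable L A fun v : δ → M => v i :=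
  RelDefinable.eq (Sum.inl i) (Sum.inr 0)

theorem const {c : M} (hc : c ∈ A) : FunDefinable L A fun _ : δ → M => c :=
  (RelDefinable.eq (L := L) (M := M) (A := A) (0 : Fin 2) 1).subst
    ![Sum.inl ⟨c, hc⟩, Sum.inr (Sum.inr 0)]

theorem comp_pred {R : M → Prop} (hf : FunDefinable L A f) (hR : PredDefinable L A R) :
    RelDefinable L A fun v => R (f v) :=
  (RelDefinable.exists_elem (R := fun v x => f v = x ∧ R x)
    (RelDefinable.and hf (RelDefinable.pred hR (Sum.inr 0)))).congr fun _ => exists_eq_left'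

theorem eq_var (hf : FunDefinable L A f) (i : δ) : RelDefinable L A fun v => f v = v i :=
  RelDefinable.comp (R := fun w : δ ⊕ Fin 1 → M => f (fun i => w (Sum.inl i)) = w (Sum.inr 0)) hf
    (Sum.elim id fun _ => i)

end FunDefinable

namespace DefGroup

variable (D : DefGroup L M) {A : Set M} {δ : Type*}

theorem mul_relDefinable (hA : D.AStar ⊆ A) (i j k : δ) :
    RelDefinable L A fun v : δ → M => D.mul (v i) (v j) = v k := by
  obtain ⟨φ, hφ, h⟩ := D.mul_definable
  refine (((RelDefinable.of_paramFormula φ hφ).mono hA).comp ![i, j, k]).congr fun v => ?_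
  rw [← h]
  refine iff_of_eq (congrArg φ.Realize (funext fun l => ?_))
  fin_cases l <;> rfl

theorem inv_relDefinable (hA : D.AStar ⊆ A) (i j : δ) :
    RelDefinable L A fun v : δ → M => D.inv (v i) = v j := by
  obtain ⟨φ, hφ, h⟩ := D.inv_definable
  refine (((RelDefinable.of_paramFormula φ hφ).mono hA).comp ![i, j]).congr fun v => ?_
  rw [← h]
  refine iff_of_eq (congrArg φ.Realize (funext fun l => ?_))
  fin_cases l <;> rfl

variable {D}

theorem funDefinable_mul (hA : D.AStar ⊆ A) {f g : (δ → M) → M} (hf : FunDefinable L A f)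
    (hg : FunDefinable L A g) : FunDefinable L A fun v => D.mul (f v) (g v) := by
  refine (RelDefinable.exists_tuple (ε := Fin 2) (δ := δ ⊕ Fin 1)
    (R := fun w u => (f (fun i => w (Sum.inl i)) = u 0 ∧ g (fun i => w (Sum.inl i)) = u 1) ∧
      D.mul (u 0) (u 1) = w (Sum.inr 0)) (.and (.and ?_ ?_) ?_)).congr fun w => ?_
  · exact RelDefinable.comp hf (Sum.elim (fun i => Sum.inl (Sum.inl i)) fun _ => Sum.inr 0)
  · exact RelDefinable.comp hg (Sum.elim (fun i => Sum.inl (Sum.inl i)) fun _ => Sum.inr 1)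
  · exact D.mul_relDefinable hA (Sum.inr 0) (Sum.inr 1) (Sum.inl (Sum.inr 0))
  · constructor
    · rintro ⟨u, ⟨h₀, h₁⟩, h⟩
      beta_reduce
      rw [h₀, h₁, h]
    · exact fun h => ⟨![f fun i => w (Sum.inl i), g fun i => w (Sum.inl i)], ⟨rfl, rfl⟩, h⟩

theorem funDefinable_inv (hA : D.AStar ⊆ A) {f : (δ → M) → M} (hf : FunDefinable L A f) :
    FunDefinable L A fun v => D.inv (f v) := by
  refine (RelDefinable.exists_elem (δ := δ ⊕ Fin 1)
    (R := fun w u => f (fun i => w (Sum.inl i)) = u ∧ D.inv u = w (Sum.inr 0))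
      (.and ?_ ?_)).congr fun w => exists_eq_left'
  · exact RelDefinable.comp hf (Sum.elim (fun i => Sum.inl (Sum.inl i)) fun _ => Sum.inr 0)
  · exact D.inv_relDefinable hA (Sum.inr 0) (Sum.inl (Sum.inr 0))

/-- The group structure on the carrier of an abelian type-definable group. -/
abbrev commGroup (habel : D.IsAbelian) : CommGroup D.carrier where
  mul x y := ⟨D.mul x y, D.mul_mem' x x.2 y y.2⟩
  mul_assoc x y z := Subtype.ext (D.mul_assoc' x x.2 y y.2 z z.2)
  one := ⟨D.one, D.one_mem'⟩
  one_mul x := Subtype.ext (D.one_mul' x x.2)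
  mul_one x := Subtype.ext (D.mul_one' x x.2)
  inv x := ⟨D.inv x, D.inv_mem' x x.2⟩
  inv_mul_cancel x := Subtype.ext (D.inv_mul' x x.2)
  mul_comm x y := Subtype.ext (habel x x.2 y y.2)

/-! ### Approximations of the set of triple products of quotients of equivalent elements -/

variable (D) in
/-- A finite part of the type defining `G` together with finitely many formulas in one
object variable. -/
abbrev Approx : Type u :=
  Finset {φ : L.Formula (D.AStar ⊕ Fin 1) //
    ∀ a ∈ D.carrier, φ.Realize (Sum.elim Subtype.val fun _ => a)} ×
      Finset (L.Formula (Fin 1 ⊕ ℕ))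

/-- `t 0` is the quotient of `t 1` and `t 2`, which cannot be distinguished by the formulas
of `q` with parameters `n`; the three elements belong to `G` as far as `q` can see. -/
def IsQuot (q : D.Approx) (t : Fin 3 → M) (n : ℕ → M) : Prop :=
  (∀ j, ∀ φ : q.1, φ.1.1.Realize (Sum.elim Subtype.val fun _ => t j)) ∧
    (∀ φ : q.2, φ.1.Realize (Sum.elim (fun _ => t 1) n) ↔
      φ.1.Realize (Sum.elim (fun _ => t 2) n)) ∧
    D.mul (D.inv (t 1)) (t 2) = t 0

/-- `d` is a product of three quotients in the sense of `IsQuot`. -/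
def IsTriple (q : D.Approx) (d : M) (n : ℕ → M) : Prop :=
  ∃ t : Fin 3 × Fin 3 → M, (∀ i, IsQuot q (fun j => t (i, j)) n) ∧
    D.mul (D.mul (t (0, 0)) (t (1, 0))) (t (2, 0)) = d

theorem isQuot_relDefinable (q : D.Approx) (g : Fin 3 → δ) (k : ℕ → δ) :
    RelDefinable L D.AStar fun v : δ → M => IsQuot q (fun j => v (g j)) fun i => v (k i) := by
  have hform : ∀ (φ : L.Formula (Fin 1 ⊕ ℕ)) (i : δ), RelDefinable L D.AStar fun v : δ → M =>
      φ.Realize (Sum.elim (fun _ => v i) fun i => v (k i)) := by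
    intro φ i
    refine ⟨φ.relabel (Sum.elim (fun _ => Sum.inr i) fun j => Sum.inr (k j)), fun v => ?_⟩
    rw [FirstOrder.Language.Formula.realize_relabel]
    refine iff_of_eq (congrArg φ.Realize (funext fun z => ?_))
    rcases z with z | z <;> rfl
  refine .and (.forall_finite fun j => .forall_finite fun φ => ?_)
    (.and (.forall_finite fun φ => .iff (hform _ _) (hform _ _)) ?_)
  · exact RelDefinable.pred (R := fun a => φ.1.1.Realize (Sum.elim Subtype.val fun _ => a))
      ⟨φ.1.1, fun v => iff_of_eq (by
        congr 2
        ext i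
        rw [Subsingleton.elim i 0])⟩ _
  · exact (funDefinable_mul subset_rfl (funDefinable_inv subset_rfl (.var _)) (.var _)).eq_var _

theorem exists_isQuot_relDefinable (q : D.Approx) :
    RelDefinable L D.AStar fun v : Fin 1 ⊕ ℕ → M =>
      ∃ t : Fin 3 → M, IsQuot q t (fun i => v (Sum.inr i)) ∧ t 0 = v (Sum.inl 0) :=
  RelDefinable.exists_tuple (R := fun v t => IsQuot q t (fun i => v (Sum.inr i)) ∧
    t 0 = v (Sum.inl 0)) (.and (isQuot_relDefinable q Sum.inr fun i => Sum.inl (Sum.inr i))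
      (.eq _ _))

theorem isTriple_relDefinable (q : D.Approx) :
    RelDefinable L D.AStar fun v : Fin 1 ⊕ ℕ → M =>
      IsTriple q (v (Sum.inl 0)) fun i => v (Sum.inr i) :=
  RelDefinable.exists_tuple (R := fun v t => (∀ i, IsQuot q (fun j => t (i, j))
    (fun i => v (Sum.inr i))) ∧
      D.mul (D.mul (t (0, 0)) (t (1, 0))) (t (2, 0)) = v (Sum.inl 0))
    (.and (.forall_finite fun i => isQuot_relDefinable q (fun j => Sum.inr (i, j))
        fun i => Sum.inl (Sum.inr i))
      ((funDefinable_mul subset_rfl (funDefinable_mul subset_rfl (.var _) (.var _))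
        (.var _)).eq_var (Sum.inl (Sum.inl 0))))

end DefGroup

/-- `a` and `b` have the same type over `C`. -/
def EquivOver (L : FirstOrder.Language.{u, u}) {M : Type u} [L.Structure M] (C : Set M)
    (a b : M) : Prop :=
  ∀ R : M → Prop, PredDefinable L C R → (R a ↔ R b)

theorem EquivOver.mono {B C : Set M} {a b : M} (h : EquivOver L C a b) (hBC : B ⊆ C) :
    EquivOver L B a b :=
  fun R hR => h R (hR.mono hBC)

namespace DefGroup

variable {D : DefGroup L M} {A C : Set M} {q : D.Approx} {n : ℕ → M}

variable (D) in
/-- `d` is a quotient of two elements of `G` with the same type over `C`. -/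
def IsTypeQuot (C : Set M) (d : M) : Prop :=
  ∃ a ∈ D.carrier, ∃ b ∈ D.carrier, EquivOver L C a b ∧ D.mul (D.inv a) b = d

theorem IsTypeQuot.mem {d : M} (h : D.IsTypeQuot C d) : d ∈ D.carrier := by
  obtain ⟨a, ha, b, hb, -, rfl⟩ := h
  exact D.mul_mem' _ (D.inv_mem' _ ha) _ hb

theorem IsTypeQuot.mono {B : Set M} {d : M} (h : D.IsTypeQuot C d) (hBC : B ⊆ C) :
    D.IsTypeQuot B d := by
  obtain ⟨a, ha, b, hb, hab, hd⟩ := h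
  exact ⟨a, ha, b, hb, hab.mono hBC, hd⟩

theorem exists_isQuot {a b : M} (ha : a ∈ D.carrier) (hb : b ∈ D.carrier)
    (hab : ∀ φ ∈ q.2, φ.Realize (Sum.elim (fun _ => a) n) ↔ φ.Realize (Sum.elim (fun _ => b) n)) :
    ∃ t, IsQuot q t n ∧ t 0 = D.mul (D.inv a) b := by
  refine ⟨![D.mul (D.inv a) b, a, b], ⟨fun j φ => φ.1.2 _ ?_, fun φ => hab _ φ.2, rfl⟩, rfl⟩
  fin_cases j
  · exact D.mul_mem' _ (D.inv_mem' _ ha) _ hb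
  · exact ha
  · exact hb

theorem IsTypeQuot.exists_isQuot {d : M} (h : D.IsTypeQuot C d) (hn : Set.range n ⊆ C) :
    ∃ t, IsQuot q t n ∧ t 0 = d := by
  obtain ⟨a, ha, b, hb, hab, rfl⟩ := h
  exact DefGroup.exists_isQuot ha hb fun φ _ => hab (fun a => φ.Realize (Sum.elim (fun _ => a) n))
    ((RelDefinable.of_formula φ n fun i => hn ⟨i, rfl⟩).congr fun v => iff_of_eq (by
      congr 2
      ext i
      rw [Subsingleton.elim i 0]))

theorem IsTriple.of_isQuot {d₁ d₂ d₃ : M} (h₁ : ∃ t, IsQuot q t n ∧ t 0 = d₁)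
    (h₂ : ∃ t, IsQuot q t n ∧ t 0 = d₂) (h₃ : ∃ t, IsQuot q t n ∧ t 0 = d₃) :
    IsTriple q (D.mul (D.mul d₁ d₂) d₃) n := by
  obtain ⟨t₁, h₁, rfl⟩ := h₁
  obtain ⟨t₂, h₂, rfl⟩ := h₂
  obtain ⟨t₃, h₃, rfl⟩ := h₃
  refine ⟨fun p => ![t₁, t₂, t₃] p.1 p.2, fun i => ?_, rfl⟩
  fin_cases i
  · exact h₁
  · exact h₂
  · exact h₃

/-- In a dependent theory, quotients of elements with the same type over a suitable countable
set are, up to a given approximation, products of three quotients of elements with the same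
type over any given sequence. -/
theorem exists_countable_forall_isTriple {κ : Cardinal.{u}} (hsat : Saturated L M κ)
    (hκ : ℵ₀ ≤ κ) (hdep : IsDependent L M) (hA : #D.AStar < κ) (habel : D.IsAbelian)
    (q : D.Approx) :
    ∃ C : Set M, C.Countable ∧ ∀ d, D.IsTypeQuot C d → ∀ n, IsTriple q d n := by
  classical
  let _ := commGroup habel
  by_contra! hC
  obtain ⟨f, hf, hlt⟩ := exists_seq_of_forall_finset_exists
    (fun p : D.carrier × (ℕ → M) => ¬ IsTriple q p.1.1 p.2)
    (fun p p' => D.IsTypeQuot (Set.range p.2) p'.1.1) fun s _ => by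
      obtain ⟨d, hd, n, hn⟩ := hC (⋃ p ∈ s, Set.range p.2)
        (s.countable_toSet.biUnion fun p _ => Set.countable_range _)
      exact ⟨(⟨d, hd.mem⟩, n), hn, fun p hp => hd.mono
        (Set.subset_iUnion₂ (s := fun p (_ : p ∈ s) => Set.range p.2) p hp)⟩
  obtain ⟨k, hk⟩ := hdep.exists_bound hsat hκ hA (exists_isQuot_relDefinable q)
  obtain ⟨s, hs, col, hcol⟩ := exists_strictMono_homogeneous k
    fun t => {z : Finset (Fin k) × Fin k × q.2 |
      z.2.2.1.Realize (Sum.elim (fun _ => (∏ i ∈ z.1, (f (t i)).1).1) (f (t z.2.1)).2)}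
  refine hk (fun i => (f (s (2 * i))).2) fun u => ?_
  let x : Finset (Fin k) → D.carrier := fun v => ∏ i ∈ v, (f (s (2 * i + 1))).1
  let y : Finset (Fin k) → D.carrier := fun v => ∏ i ∈ v, (f (s (2 * i))).1
  have hxy : ∀ v, ∀ j ∉ v, ∀ φ ∈ q.2,
      φ.Realize (Sum.elim (fun _ => (x v).1) (f (s (2 * j))).2) ↔
        φ.Realize (Sum.elim (fun _ => (y v).1) (f (s (2 * j))).2) := by
    intro v j hj φ hφ
    have h₁ := hcol (fun i => 2 * i) fun a b h => by
      have : a.1 < b.1 := h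
      change 2 * a.1 < 2 * b.1
      omega
    have h₂ := hcol (fun i => if i = j then 2 * i else 2 * i + 1) fun a b h => by
      have : a.1 < b.1 := h
      dsimp only
      split_ifs <;> omega
    have h₃ := Set.ext_iff.1 (h₂.trans h₁.symm) (v, j, ⟨φ, hφ⟩)
    simp only [Set.mem_ofPred_eq, if_true] at h₃
    have e : (∏ i ∈ v, (f (s (if i = j then 2 * i.1 else 2 * i.1 + 1))).1) = x v :=
      Finset.prod_congr rfl fun i hi => by rw [if_neg (by rintro rfl; exact hj hi)]
    rw [e] at h₃
    exact h₃
  refine ⟨((x {i | i.1 ∉ u})⁻¹ * y {i | i.1 ∉ u} : D.carrier),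
    fun i hi => ⟨fun h => ?_, fun h => ?_⟩⟩
  · by_contra hiu
    set v : Finset (Fin k) := {i | i.1 ∉ u}
    obtain ⟨j, rfl⟩ : ∃ j : Fin k, j.1 = i := ⟨⟨i, hi⟩, rfl⟩
    have hjv : j ∈ v := by simpa [v] using hiu
    have hx : (f (s (2 * j + 1))).1 * x (v.erase j) = x v :=
      Finset.mul_prod_erase v (fun i : Fin k => (f (s (2 * i + 1))).1) hjv
    have hy : (f (s (2 * j))).1 * y (v.erase j) = y v :=
      Finset.mul_prod_erase v (fun i : Fin k => (f (s (2 * i))).1) hjv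
    have hinv : ∃ t, IsQuot q t (f (s (2 * j))).2 ∧
        t 0 = ((y (v.erase j))⁻¹ * x (v.erase j) : D.carrier).1 :=
      exists_isQuot (y _).2 (x _).2 fun φ hφ => (hxy _ j (Finset.notMem_erase _ _) φ hφ).symm
    have hd : ∃ t, IsQuot q t (f (s (2 * j))).2 ∧ t 0 = (f (s (2 * j + 1))).1.1 :=
      (hlt _ _ (hs (Nat.lt_succ_self _))).exists_isQuot subset_rfl
    refine hf (s (2 * j)) ?_
    have e : (f (s (2 * j))).1 = (x v)⁻¹ * y v * ((y (v.erase j))⁻¹ * x (v.erase j)) *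
        (f (s (2 * j + 1))).1 := by
      rw [← hx, ← hy, mul_inv_rev, mul_assoc, mul_assoc, mul_assoc, mul_assoc, mul_assoc,
        mul_inv_cancel_left, mul_comm (x _), mul_left_comm _ (f (s (2 * j + 1))).1,
        inv_mul_cancel_left, mul_comm _ (x _), inv_mul_cancel_left]
    rw [e]
    exact IsTriple.of_isQuot h hinv hd
  · exact exists_isQuot (x _).2 (y _).2 fun φ hφ => hxy _ ⟨i, hi⟩ (by simpa using h) φ hφ

end DefGroup

universe v

theorem mk_formula_le (α : Type v) {c : Cardinal.{max u v}} (hc : ℵ₀ ≤ c)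
    (hα : Cardinal.lift.{u} #α ≤ c) (hL : Cardinal.lift.{v} (theoryCard L) ≤ c) :
    #(L.Formula α) ≤ c := by
  have h : #(L.Formula α) ≤ #(Σ n, L.BoundedFormula α n) :=
    Cardinal.mk_le_of_injective (f := fun φ : L.Formula α => (⟨0, φ⟩ : Σ n, L.BoundedFormula α n))
      fun φ ψ h => by simpa using h
  refine (h.trans FirstOrder.Language.BoundedFormula.card_le).trans
    (max_le hc (Cardinal.add_le_of_le hc hα ((Cardinal.lift_le.2 ?_).trans hL)))
  exact le_sup_right

theorem mk_finset_le {α : Type u} {c : Cardinal.{u}} (hc : ℵ₀ ≤ c) (h : #α ≤ c) :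
    #(Finset α) ≤ c := by
  cases finite_or_infinite α
  · exact (Cardinal.lt_aleph0_of_finite _).le.trans hc
  · rwa [Cardinal.mk_finset_of_infinite]

namespace DefGroup

variable {D : DefGroup L M}

variable (D) in
theorem mk_approx_le : #D.Approx ≤ #D.AStar ⊔ theoryCard L := by
  have h₀ : ℵ₀ ≤ #D.AStar ⊔ theoryCard L := le_sup_left.trans le_sup_right
  rw [Approx, Cardinal.mk_prod, Cardinal.lift_id, Cardinal.lift_id]
  refine Cardinal.mul_le_of_le h₀ (mk_finset_le h₀ ?_) (mk_finset_le h₀ ?_)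
  · refine (Cardinal.mk_subtype_le _).trans ?_
    refine mk_formula_le _ h₀ ?_ (by simp)
    rw [Cardinal.lift_id, Cardinal.mk_sum, Cardinal.lift_uzero]
    exact Cardinal.add_le_of_le h₀ le_sup_left ((by simp : _ ≤ ℵ₀).trans h₀)
  · exact mk_formula_le _ h₀ ((by simp : _ ≤ ℵ₀).trans h₀) (by simp)

variable (D) in
/-- The elements of `G` which are, up to every approximation, products of three quotients of
elements with the same type. -/
def core : Set M :=
  {d | d ∈ D.carrier ∧ ∀ (q : D.Approx) (n : ℕ → M), IsTriple q d n}

theorem exists_representatives {κ : Cardinal.{u}} (hsat : Saturated L M κ)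
    (hκ : ℵ₀ ≤ κ) (hdep : IsDependent L M) (hA : #D.AStar < κ) (habel : D.IsAbelian) :
    ∃ S ⊆ D.carrier, #S ≤ 2 ^ (#D.AStar ⊔ theoryCard L) ∧
      ∀ g ∈ D.carrier, ∃ s ∈ S, D.mul (D.inv s) g ∈ D.core := by
  choose C hC hCq using exists_countable_forall_isTriple hsat hκ hdep hA habel
  have h₀ : ℵ₀ ≤ #D.AStar ⊔ theoryCard L := le_sup_left.trans le_sup_right
  have hcard : #(⋃ q, C q : Set M) ≤ #D.AStar ⊔ theoryCard L := by
    refine (Cardinal.mk_iUnion_le_sum_mk.trans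
      (Cardinal.sum_le_sum _ (fun _ => ℵ₀) fun q => (hC q).le_aleph0)).trans ?_
    rw [Cardinal.sum_const']
    exact Cardinal.mul_le_of_le h₀ D.mk_approx_le h₀
  let τ : D.carrier → Set (L.Formula ((⋃ q, C q : Set M) ⊕ Fin 1)) :=
    fun g => {φ | φ.Realize (Sum.elim Subtype.val fun _ => g)}
  have hτ : ∀ a b, τ a = τ b → EquivOver L (⋃ q, C q) (a : M) b := by
    rintro a b h R ⟨φ, hφ⟩
    exact (hφ fun _ => a).symm.trans ((Set.ext_iff.1 h φ).trans (hφ fun _ => b))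
  choose r hr using fun x : Set.range τ => x.2
  refine ⟨Set.range fun x => (r x).1, ?_, ?_, fun g hg => ?_⟩
  · rintro _ ⟨x, rfl⟩
    exact (r x).2
  · refine Cardinal.mk_range_le.trans ((Cardinal.mk_set_le _).trans ?_)
    rw [Cardinal.mk_set]
    refine Cardinal.power_le_power_left two_ne_zero (mk_formula_le _ h₀ ?_ (by simp))
    rw [Cardinal.lift_id, Cardinal.mk_sum, Cardinal.lift_uzero]
    exact Cardinal.add_le_of_le h₀ hcard ((by simp : _ ≤ ℵ₀).trans h₀)
  · refine ⟨_, ⟨⟨τ ⟨g, hg⟩, ⟨g, hg⟩, rfl⟩, rfl⟩, ?_⟩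
    have hq : D.IsTypeQuot (⋃ q, C q) (D.mul (D.inv (r ⟨τ ⟨g, hg⟩, ⟨g, hg⟩, rfl⟩)) g) :=
      ⟨_, (r _).2, g, hg, hτ _ ⟨g, hg⟩ (hr _), rfl⟩
    exact ⟨hq.mem, fun q n => hCq q _ (hq.mono (Set.subset_iUnion _ _)) n⟩

end DefGroup

namespace EquivOver

variable {A : Set M} {a b : M}

theorem symm (h : EquivOver L A a b) : EquivOver L A b a :=
  fun R hR => (h R hR).symm

theorem isUltralimit (h : EquivOver L A a b) :
    IsUltralimit L A (pure () : Ultrafilter Unit) (fun _ : Fin 1 => a) fun _ _ => b := by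
  intro R hR
  have hR' : PredDefinable L A fun a => R fun _ => a := hR.congr fun v => iff_of_eq (by
    congr 1
    ext i
    rw [Subsingleton.elim i 0])
  simpa using h _ hR'

theorem of_mem_typeOf (h : b ∈ realizeSet (typeOf (L := L) A a)) : EquivOver L A a b := by
  have key : ∀ R : M → Prop, PredDefinable L A R → R a → R b := by
    intro R hR hRa
    obtain ⟨f, hf, hfR⟩ := hR.exists_fin_params
    exact (hfR fun _ => b).1 (h f ⟨hf, (hfR fun _ => a).2 hRa⟩)
  refine fun R hR => ⟨key R hR, fun hb => ?_⟩
  by_contra ha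
  exact key (fun a => ¬ R a) (RelDefinable.not hR) ha hb

end EquivOver

namespace DefGroup

variable {D : DefGroup L M} {κ : Cardinal.{u}} {a b : M}

theorem mem_carrier_of_equivOver (h : EquivOver L D.AStar a b) (ha : a ∈ D.carrier) :
    b ∈ D.carrier :=
  fun f hf => (h _ (.of_paramFormula (D.pStar_over f hf))).1 (ha f hf)

theorem mem_core_of_equivOver (hsat : Saturated L M κ) (hκ : ℵ₀ ≤ κ) (hA : #D.AStar < κ)
    (h : EquivOver L D.AStar a b) (ha : a ∈ D.core) : b ∈ D.core := by
  refine ⟨mem_carrier_of_equivOver h ha.1, fun q n => ?_⟩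
  obtain ⟨n', hn'⟩ := h.isUltralimit.exists_seq hsat hκ hA
    (((Set.finite_range _).lt_aleph0).trans_le hκ) fun _ => n
  exact (hn' _ (isTriple_relDefinable q)).1 (ha.2 q n')

variable (D) in
/-- The subgroup of `G` generated by the core. -/
def hull : Set M :=
  {d | ∀ X, D.IsSubgroup X → D.core ⊆ X → d ∈ X}

theorem isSubgroup_carrier : D.IsSubgroup D.carrier :=
  ⟨subset_rfl, D.one_mem', D.mul_mem', D.inv_mem'⟩

theorem isSubgroup_hull : D.IsSubgroup D.hull :=
  ⟨fun _ h => h _ isSubgroup_carrier fun _ h => h.1, fun _ hX _ => hX.2.1,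
    fun _ hx _ hy X hX hc => hX.2.2.1 _ (hx X hX hc) _ (hy X hX hc),
    fun _ hx X hX hc => hX.2.2.2 _ (hx X hX hc)⟩

theorem core_subset_hull : D.core ⊆ D.hull := fun _ hx _ _ hc => hc hx

theorem mem_hull_of_equivOver (hsat : Saturated L M κ) (hκ : ℵ₀ ≤ κ) (hA : #D.AStar < κ)
    (habel : D.IsAbelian) (h : EquivOver L D.AStar a b) (ha : a ∈ D.hull) : b ∈ D.hull := by
  let _ := commGroup habel
  have hH := isSubgroup_hull (D := D)
  refine (ha {d | d ∈ D.hull ∧ ∀ d', EquivOver L D.AStar d d' → d' ∈ D.hull}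
    ⟨fun x hx => hH.1 hx.1, ⟨hH.2.1, fun d' hd' => ?_⟩,
    fun x hx y hy => ⟨hH.2.2.1 x hx.1 y hy.1, fun d' hd' => ?_⟩,
    fun x hx => ⟨hH.2.2.2 x hx.1, fun d' hd' => ?_⟩⟩ fun x hx => ⟨core_subset_hull hx,
      fun d' hd' => core_subset_hull (mem_core_of_equivOver hsat hκ hA hd' hx)⟩).2 b h
  · obtain ⟨φ, hφ, hφ'⟩ := D.one_definable
    have e : ∀ x, φ.Realize (fun _ => x) ↔ x = D.one := fun x => by
      rw [← hφ']
      refine iff_of_eq (congrArg φ.Realize (funext fun i => ?_))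
      rw [Subsingleton.elim i 0]
      rfl
    rw [(e d').1 ((hd' _ (.of_paramFormula hφ)).1 ((e _).2 rfl))]
    exact hH.2.1
  · obtain ⟨s, hs⟩ := hd'.symm.isUltralimit.exists_elem hsat hκ hA
      (((Set.finite_range _).lt_aleph0).trans_le hκ) fun _ => x
    have hsx : EquivOver L D.AStar x s := fun R hR => by
      simpa using (hs _ (RelDefinable.pred hR (Sum.inr 0))).symm
    have hty : EquivOver L D.AStar (D.mul (D.inv x) (D.mul x y)) (D.mul (D.inv s) d') :=
      fun R hR => by
        simpa using (hs _ ((funDefinable_mul subset_rfl (funDefinable_inv subset_rfl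
          (.var (Sum.inr 0))) (.var (Sum.inl 0))).comp_pred hR)).symm
    have hxG := hH.1 hx.1
    have hyG := hH.1 hy.1
    have hsG := mem_carrier_of_equivOver hsx hxG
    have hdG := mem_carrier_of_equivOver hd' (D.mul_mem' x hxG y hyG)
    have e₁ : D.mul (D.inv x) (D.mul x y) = y :=
      congrArg Subtype.val (inv_mul_cancel_left (⟨x, hxG⟩ : D.carrier) ⟨y, hyG⟩)
    have e₂ : D.mul s (D.mul (D.inv s) d') = d' :=
      congrArg Subtype.val (mul_inv_cancel_left (⟨s, hsG⟩ : D.carrier) ⟨d', hdG⟩)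
    rw [e₁] at hty
    rw [← e₂]
    exact hH.2.2.1 _ (hx.2 s hsx) _ (hy.2 _ hty)
  · have hxG := hH.1 hx.1
    have hdG := mem_carrier_of_equivOver hd' (D.inv_mem' x hxG)
    have hinv : EquivOver L D.AStar (D.inv (D.inv x)) (D.inv d') := fun R hR =>
      hd' (fun a => R (D.inv a)) ((funDefinable_inv subset_rfl (.var 0)).comp_pred hR)
    have e₁ : D.inv (D.inv x) = x := congrArg Subtype.val (inv_inv (⟨x, hxG⟩ : D.carrier))
    have e₂ : D.inv (D.inv d') = d' := congrArg Subtype.val (inv_inv (⟨d', hdG⟩ : D.carrier))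
    rw [e₁] at hinv
    rw [← e₂]
    exact hH.2.2.2 _ (hx.2 _ hinv)

theorem iUnion_realizeSet_typeOf_hull (hsat : Saturated L M κ) (hκ : ℵ₀ ≤ κ)
    (hA : #D.AStar < κ) (habel : D.IsAbelian) :
    ⋃ p ∈ typeOf (L := L) D.AStar '' D.hull, realizeSet p = D.hull := by
  ext x
  simp only [Set.mem_iUnion, Set.mem_image, exists_prop]
  constructor
  · rintro ⟨_, ⟨a, ha, rfl⟩, hx⟩
    exact mem_hull_of_equivOver hsat hκ hA habel (.of_mem_typeOf hx) ha
  · exact fun hx => ⟨_, ⟨x, hx, rfl⟩, fun f hf => hf.2⟩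

/-- By compactness, elements of the core are honest products of three quotients of elements
with the same type over a given small set. -/
theorem exists_isTypeQuot_of_mem_core (hsat : Saturated L M κ) (hκ : ℵ₀ ≤ κ) {N : Set M}
    (hN : #N < κ) (hAN : D.AStar ⊆ N) {d : M} (hd : d ∈ D.core) :
    ∃ x : Fin 3 → M, (∀ i, D.IsTypeQuot N (x i)) ∧ D.mul (D.mul (x 0) (x 1)) (x 2) = d := by
  classical
  have : Nonempty M := ⟨d⟩
  have key : ∀ k : Finset {φ : L.Formula (D.AStar ⊕ Fin 1) //
      ∀ a ∈ D.carrier, φ.Realize (Sum.elim Subtype.val fun _ => a)} ×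
        Finset {R : M → Prop // PredDefinable L N R},
      ∃ t : Fin 3 × Fin 3 → M,
        (∀ p, ∀ φ ∈ k.1, φ.1.Realize (Sum.elim Subtype.val fun _ => t p)) ∧
        (∀ i, ∀ R ∈ k.2, R.1 (t (i, 1)) ↔ R.1 (t (i, 2))) ∧
        (∀ i, D.mul (D.inv (t (i, 1))) (t (i, 2)) = t (i, 0)) ∧
        D.mul (D.mul (t (0, 0)) (t (1, 0))) (t (2, 0)) = d := by
    rintro ⟨s, r⟩
    choose B hB hBN hR using fun R : {R : M → Prop // PredDefinable L N R} =>
      R.2.exists_finite_params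
    obtain ⟨n, hn⟩ := Set.Countable.exists_eq_range
      (s := insert d (⋃ R ∈ r, B R))
      ((r.countable_toSet.biUnion fun R _ => (hB R).countable).insert d)
      (Set.insert_nonempty _ _)
    have hform : ∀ R : r, ∃ φ : L.Formula (Fin 1 ⊕ ℕ),
        ∀ v : Fin 1 → M, φ.Realize (Sum.elim v n) ↔ R.1.1 (v 0) := fun R =>
      ((hR R.1).mono (hn ▸ (Set.subset_iUnion₂ (s := fun R (_ : R ∈ r) => B R) R.1 R.2).trans
        (Set.subset_insert _ _))).exists_formula_of_range
    choose φ hφ using hform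
    obtain ⟨t, ht, htd⟩ := hd.2 (s, Finset.univ.image φ) n
    refine ⟨t, fun p ψ hψ => (ht p.1).1 p.2 ⟨ψ, hψ⟩, fun i R hRr => ?_, fun i => (ht i).2.2, htd⟩
    have h := (ht i).2.1 ⟨φ ⟨R, hRr⟩, Finset.mem_image_of_mem _ (Finset.mem_univ _)⟩
    exact (hφ ⟨R, hRr⟩ fun _ => t (i, 1)).symm.trans (h.trans (hφ ⟨R, hRr⟩ fun _ => t (i, 2)))
  choose t htφ htR htq htd using key
  have hNd : #(insert d N : Set M) < κ :=
    Cardinal.mk_insert_le.trans_lt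
      (Cardinal.add_lt_of_lt hκ hN (Cardinal.one_lt_aleph0.trans_le hκ))
  have hsub : N ⊆ insert d N := Set.subset_insert _ _
  have hU := Ultrafilter.of_le (Filter.atTop : Filter (Finset {φ : L.Formula (D.AStar ⊕ Fin 1) //
    ∀ a ∈ D.carrier, φ.Realize (Sum.elim Subtype.val fun _ => a)} ×
      Finset {R : M → Prop // PredDefinable L N R}))
  obtain ⟨b, hb⟩ := hsat.exists_isUltralimit hκ hNd (Ultrafilter.of Filter.atTop) t
  have hG : ∀ p, b p ∈ D.carrier := by
    intro p f hf
    obtain ⟨φ, hφ⟩ := PredDefinable.of_paramFormula (D.pStar_over f hf)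
    refine (hb _ ((RelDefinable.pred (PredDefinable.of_paramFormula (D.pStar_over f hf)) p).mono
      (hAN.trans hsub))).2 (hU ?_)
    refine (Filter.eventually_ge_atTop ({⟨φ, fun a ha => (hφ fun _ => a).2 (ha f hf)⟩}, ∅)).mono
      fun k hk => (hφ fun _ => t k p).1 (htφ k p _ (hk.1 (Finset.mem_singleton_self _)))
  have hquot : ∀ i, D.mul (D.inv (b (i, 1))) (b (i, 2)) = b (i, 0) := fun i =>
    (hb _ ((funDefinable_mul (hAN.trans hsub) (funDefinable_inv (hAN.trans hsub) (.var _))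
      (.var _)).eq_var _)).2 (.of_forall fun k => htq k i)
  refine ⟨fun i => b (i, 0), fun i => ⟨b (i, 1), hG _, b (i, 2), hG _, fun R hR => ?_, hquot i⟩, ?_⟩
  · refine (hb _ (((RelDefinable.pred hR (i, 1)).iff (RelDefinable.pred hR (i, 2))).mono hsub)).2
      (hU ?_)
    exact (Filter.eventually_ge_atTop (∅, {⟨R, hR⟩})).mono
      fun k hk => htR k i _ (hk.2 (Finset.mem_singleton_self _))
  · have hdef : PredDefinable L (insert d N) fun x => x = d :=
      (RelDefinable.eq (L := L) (M := M) (A := insert d N) (0 : Fin 2) 1).subst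
        ![Sum.inr 0, Sum.inl ⟨d, Set.mem_insert _ _⟩]
    exact (hb _ ((funDefinable_mul (hAN.trans hsub) (funDefinable_mul (hAN.trans hsub)
      (.var (0, 0)) (.var (1, 0))) (.var (2, 0))).comp_pred hdef)).2 (.of_forall fun k => htd k)

theorem hull_subset_of_indexLT (hsat : Saturated L M κ) (hκ : ℵ₀ ≤ κ) (hA : #D.AStar < κ)
    (habel : D.IsAbelian) {B X : Set M} (hB : #B < κ) (hXB : UnionTypeDefOver L X B κ)
    (hX : D.IsSubgroup X) (hind : D.indexLT X κ) : D.hull ⊆ X := by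
  let _ := commGroup habel
  obtain ⟨S, hSG, hSκ, hS⟩ := hind
  obtain ⟨ι, -, P, hP, rfl⟩ := hXB
  have hN : #((D.AStar ∪ B) ∪ S : Set M) < κ :=
    (Cardinal.mk_union_le _ _).trans_lt (Cardinal.add_lt_of_lt hκ
      ((Cardinal.mk_union_le _ _).trans_lt (Cardinal.add_lt_of_lt hκ hA hB)) hSκ)
  have hAN : D.AStar ⊆ (D.AStar ∪ B) ∪ S := fun x hx => Or.inl (Or.inl hx)
  have hquot : ∀ d, D.IsTypeQuot ((D.AStar ∪ B) ∪ S) d → d ∈ ⋃ i, realizeSet (P i) := by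
    rintro _ ⟨a, ha, b, hb, hab, rfl⟩
    obtain ⟨s, hsS, hs⟩ := hS a ha
    have hsb : D.mul (D.inv s) b ∈ ⋃ i, realizeSet (P i) := by
      obtain ⟨i, hi⟩ := Set.mem_iUnion.1 hs
      refine Set.mem_iUnion.2 ⟨i, fun f hf => ?_⟩
      exact (hab (fun a => f.Realize fun _ => D.mul (D.inv s) a)
        ((funDefinable_mul hAN (funDefinable_inv hAN
        (.const (c := s) (Or.inr hsS))) (.var 0)).comp_pred
          ((PredDefinable.of_paramFormula (hP i f hf)).mono
            fun x hx => Or.inl (Or.inr hx)))).1 (hi f hf)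
    have e : D.mul (D.inv a) b = D.mul (D.inv (D.mul (D.inv s) a)) (D.mul (D.inv s) b) :=
      congrArg Subtype.val (show (⟨a, ha⟩ : D.carrier)⁻¹ * ⟨b, hb⟩ =
        ((⟨s, hSG hsS⟩ : D.carrier)⁻¹ * ⟨a, ha⟩)⁻¹ * ((⟨s, hSG hsS⟩ : D.carrier)⁻¹ * ⟨b, hb⟩) by
          rw [mul_inv_rev, inv_inv, mul_assoc, mul_inv_cancel_left])
    rw [e]
    exact hX.2.2.1 _ (hX.2.2.2 _ hs) _ hsb
  refine fun x hx => hx _ hX fun d hd => ?_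
  obtain ⟨y, hy, rfl⟩ := exists_isTypeQuot_of_mem_core hsat hκ hN hAN hd
  exact hX.2.2.1 _ (hX.2.2.1 _ (hquot _ (hy 0)) _ (hquot _ (hy 1))) _ (hquot _ (hy 2))

end DefGroup

/-- Theorem 1.11 of [Sh:886]: if `T` is dependent and `G` abelian, there is a set `P` of
complete types over `A*` such that `P(𝔠)` is a subgroup of `G` of bounded index, in fact of
index `≤ 2^{|A*|+|T|+ℵ₀}`, and `P(𝔠)` is minimal: an `L_{∞,κ̄}`-definable subgroup of `G`
(i.e. a union of `< κ̄` realization sets of types over a tuple `ā`) has bounded index iff it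
contains `P(𝔠)`. -/
theorem theorem_h24
    {L : FirstOrder.Language.{u, u}} {M : Type u} [L.Structure M]
    (κbar : Cardinal.{u}) (hκinacc : κbar.IsInaccessible) (hκT : theoryCard L < κbar)
    (hκsat : Saturated L M κbar)
    (hdep : IsDependent L M)
    (D : DefGroup L M) (hAκ : #(D.AStar) < κbar) (habel : D.IsAbelian) :
    ∃ P : Set (Set (ParamFormula L M 1)),
      (∀ p ∈ P, ∃ a : M, p = typeOf D.AStar a) ∧
      D.IsSubgroup (⋃ p ∈ P, realizeSet p) ∧
      D.indexLT (⋃ p ∈ P, realizeSet p) κbar ∧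
      D.indexLE (⋃ p ∈ P, realizeSet p) (2 ^ (#(D.AStar) ⊔ theoryCard L)) ∧
      (∀ (β : Type u), #β < κbar → ∀ (abar : β → M) (X : Set M),
        UnionTypeDefOver L X (Set.range abar) κbar → D.IsSubgroup X →
          (D.indexLT X κbar ↔ (⋃ p ∈ P, realizeSet p) ⊆ X)) := by
  have hκ : ℵ₀ ≤ κbar := hκinacc.aleph0_lt.le
  obtain ⟨S, hSG, hS, hrep⟩ := DefGroup.exists_representatives hκsat hκ hdep hAκ habel
  have hSκ : #S < κbar :=
    hS.trans_lt (hκinacc.isStrongLimit.isStrongPrelimit (max_lt hAκ hκT))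
  refine ⟨typeOf D.AStar '' D.hull, ?_, ?_⟩
  · rintro _ ⟨a, -, rfl⟩
    exact ⟨a, rfl⟩
  rw [DefGroup.iUnion_realizeSet_typeOf_hull hκsat hκ hAκ habel]
  have hcover : ∀ X, D.hull ⊆ X → ∀ g ∈ D.carrier, ∃ s ∈ S, D.mul (D.inv s) g ∈ X :=
    fun X hX g hg => (hrep g hg).imp fun s hs => ⟨hs.1, hX (DefGroup.core_subset_hull hs.2)⟩
  refine ⟨DefGroup.isSubgroup_hull, ⟨S, hSG, hSκ, hcover _ subset_rfl⟩,
    ⟨S, hSG, hS, hcover _ subset_rfl⟩, fun β hβ abar X hX hXG => ⟨fun hind => ?_, fun hsub =>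
      ⟨S, hSG, hSκ, hcover X hsub⟩⟩⟩
  exact DefGroup.hull_subset_of_indexLT hκsat hκ hAκ habel (Cardinal.mk_range_le.trans_lt hβ)
    hX hXG hind

end Paper886
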